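/- arXiv:2506.02879 — 2 statements merged into one kernel-verified Lean document; each statement's English description precedes it below -/
import Mathlib

section
/- (One-step compression error recursion, noiseless case) Let α ∈ (0,1), θ := 1 − √(1−α), β := (1−α)/(1−√(1−α)), η ∈ (0,1], and L ≥ 0. Let C : ℝ^{n×p} → ℝ^{n×p} satisfy ‖C(Z) − Z‖_F² ≤ (1−α)‖Z‖_F² for all Z. Let fᵢ : ℝ^{n×p} → ℝ be differentiable and let X, X⁺, v, g ∈ ℝ^{n×p} satisfy ‖∇fᵢ(X⁺) − ∇fᵢ(X)‖_F ≤ L‖X⁺ − X‖_F. Define v⁺ := (1−η)v + η∇fᵢ(X⁺) and g⁺ := g + C(v⁺ − g). Then ‖g⁺ − v⁺‖_F² ≤ (1−θ)‖g − v‖_F² + 2βη²L²‖X⁺ − X‖_F² + 2βη²‖v − ∇fᵢ(X)‖_F². -/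
open Matrix Finset

noncomputable section

/-- Frobenius inner product `⟨A, B⟩ = Tr (Aᵀ * B)`. -/
def finner {n p : ℕ} (A B : Matrix (Fin n) (Fin p) ℝ) : ℝ :=
  (Aᵀ * B).trace

/-- Frobenius norm `‖A‖_F = √(Tr (Aᵀ * A))`. -/
def fnorm {n p : ℕ} (A : Matrix (Fin n) (Fin p) ℝ) : ℝ :=
  Real.sqrt ((Aᵀ * A).trace)

/-- Skew-symmetric part `skew M = (M - Mᵀ)/2`. -/
def skewPart {m : ℕ} (M : Matrix (Fin m) (Fin m) ℝ) : Matrix (Fin m) (Fin m) ℝ :=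
  (1 / 2 : ℝ) • (M - Mᵀ)

/-- Symmetric part `sym M = (M + Mᵀ)/2`. -/
def symPart {m : ℕ} (M : Matrix (Fin m) (Fin m) ℝ) : Matrix (Fin m) (Fin m) ℝ :=
  (1 / 2 : ℝ) • (M + Mᵀ)

/-- Penalty function `N(X) = ‖XᵀX - I‖_F² / 4`. -/
def penaltyN {n p : ℕ} (X : Matrix (Fin n) (Fin p) ℝ) : ℝ :=
  (1 / 4 : ℝ) * fnorm (Xᵀ * X - 1) ^ 2

/-- Landing direction `Λ̃(X; g) = skew(g Xᵀ) X + λ X (XᵀX - I)` with gradient estimate `g`. -/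
def landingDir {n p : ℕ} (lam : ℝ) (X g : Matrix (Fin n) (Fin p) ℝ) :
    Matrix (Fin n) (Fin p) ℝ :=
  skewPart (g * Xᵀ) * X + lam • (X * (Xᵀ * X - 1))

attribute [local instance] Matrix.frobeniusNormedAddCommGroup Matrix.frobeniusNormedSpace

theorem fnorm_eq_norm {n p : ℕ} (A : Matrix (Fin n) (Fin p) ℝ) : fnorm A = ‖A‖ := by
  rw [fnorm, Matrix.frobenius_norm_def, Real.sqrt_eq_rpow, Finset.sum_comm]
  simp [Matrix.trace, Matrix.mul_apply, sq]

/-- Young's inequality with weights `s` and `s ^ 2 / (1 - s)`. -/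
theorem sq_mul_add_sq_le {s : ℝ} (hs₀ : 0 ≤ s) (hs₁ : s < 1) (a c : ℝ) :
    s ^ 2 * (a + c) ^ 2 ≤ s * a ^ 2 + s ^ 2 / (1 - s) * c ^ 2 := by
  have h : 0 < 1 - s := sub_pos.2 hs₁
  have key : s * a ^ 2 + s ^ 2 / (1 - s) * c ^ 2 - s ^ 2 * (a + c) ^ 2 =
      s * ((1 - s) * a - s * c) ^ 2 / (1 - s) := by
    field_simp
    ring
  have : 0 ≤ s * ((1 - s) * a - s * c) ^ 2 / (1 - s) := by positivity
  linarith

/-- one-step compression error recursion, noiseless case. -/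
theorem compression_error_recursion {n p : ℕ} (α θ β η L : ℝ)
    (hα : α ∈ Set.Ioo (0 : ℝ) 1)
    (hθ : θ = 1 - Real.sqrt (1 - α)) (hβ : β = (1 - α) / (1 - Real.sqrt (1 - α)))
    (hη : η ∈ Set.Ioc (0 : ℝ) 1) (hL : 0 ≤ L)
    (C : Matrix (Fin n) (Fin p) ℝ → Matrix (Fin n) (Fin p) ℝ)
    (hC : ∀ Z : Matrix (Fin n) (Fin p) ℝ, fnorm (C Z - Z) ^ 2 ≤ (1 - α) * fnorm Z ^ 2)
    (fi : Matrix (Fin n) (Fin p) ℝ → ℝ)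
    (gradfi : Matrix (Fin n) (Fin p) ℝ → Matrix (Fin n) (Fin p) ℝ)
    (hdiff : Differentiable ℝ fi)
    (hgrad : ∀ Y H : Matrix (Fin n) (Fin p) ℝ, fderiv ℝ fi Y H = finner (gradfi Y) H)
    (X Xp v g : Matrix (Fin n) (Fin p) ℝ)
    (hlip : fnorm (gradfi Xp - gradfi X) ≤ L * fnorm (Xp - X)) :
    fnorm (g + C ((1 - η) • v + η • gradfi Xp - g) - ((1 - η) • v + η • gradfi Xp)) ^ 2 ≤
      (1 - θ) * fnorm (g - v) ^ 2 + 2 * β * η ^ 2 * L ^ 2 * fnorm (Xp - X) ^ 2 +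
        2 * β * η ^ 2 * fnorm (v - gradfi X) ^ 2 := by
  obtain ⟨hα₀, hα₁⟩ := hα
  have hη₀ : 0 ≤ η := hη.1.le
  have hs₀ : 0 ≤ √(1 - α) := Real.sqrt_nonneg _
  have hs_sq : √(1 - α) ^ 2 = 1 - α := Real.sq_sqrt (by linarith)
  have hs₁ : √(1 - α) < 1 := by
    rw [Real.sqrt_lt' one_pos]
    linarith
  have hβ₀ : 0 ≤ β := hβ ▸ div_nonneg (by linarith) (by linarith)
  simp only [fnorm_eq_norm] at hC hlip ⊢
  set Z := (1 - η) • v + η • gradfi Xp - g with hZ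
  have herr : g + C Z - ((1 - η) • v + η • gradfi Xp) = C Z - Z := by
    rw [hZ]
    abel
  have hZ_le : ‖Z‖ ≤ ‖g - v‖ + η * ‖gradfi Xp - v‖ := by
    have h : Z = (v - g) + η • (gradfi Xp - v) := by
      rw [hZ]
      module
    calc ‖Z‖ ≤ ‖v - g‖ + ‖η • (gradfi Xp - v)‖ := h ▸ norm_add_le _ _
      _ = ‖g - v‖ + η * ‖gradfi Xp - v‖ := by
        rw [norm_sub_rev, norm_smul, Real.norm_of_nonneg hη₀]
  have hgrad_le : ‖gradfi Xp - v‖ ^ 2 ≤ 2 * (L * ‖Xp - X‖) ^ 2 + 2 * ‖v - gradfi X‖ ^ 2 := by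
    have h : ‖gradfi Xp - v‖ ≤ L * ‖Xp - X‖ + ‖v - gradfi X‖ :=
      (norm_sub_le_norm_sub_add_norm_sub _ (gradfi X) _).trans
        (add_le_add hlip (norm_sub_rev _ _).le)
    calc ‖gradfi Xp - v‖ ^ 2 ≤ (L * ‖Xp - X‖ + ‖v - gradfi X‖) ^ 2 := by gcongr
      _ ≤ 2 * (L * ‖Xp - X‖) ^ 2 + 2 * ‖v - gradfi X‖ ^ 2 := by
        linarith [add_sq_le (a := L * ‖Xp - X‖) (b := ‖v - gradfi X‖)]
  have hyoung := sq_mul_add_sq_le hs₀ hs₁ ‖g - v‖ (η * ‖gradfi Xp - v‖)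
  rw [hs_sq, ← hβ] at hyoung
  rw [herr]
  calc ‖C Z - Z‖ ^ 2 ≤ (1 - α) * ‖Z‖ ^ 2 := hC Z
    _ ≤ (1 - α) * (‖g - v‖ + η * ‖gradfi Xp - v‖) ^ 2 := by
      have : 0 ≤ 1 - α := by linarith
      gcongr
    _ ≤ (1 - θ) * ‖g - v‖ ^ 2 + β * η ^ 2 * ‖gradfi Xp - v‖ ^ 2 := by
      rw [hθ]
      linarith
    _ ≤ (1 - θ) * ‖g - v‖ ^ 2 +
        β * η ^ 2 * (2 * (L * ‖Xp - X‖) ^ 2 + 2 * ‖v - gradfi X‖ ^ 2) := by gcongr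
    _ = _ := by ring
end
end

section
/- Let ε ∈ (0, 3/4) and X ∈ St(p,n)^ε. Then for all g, h ∈ ℝ^{n×p}, ⟨skew(g Xᵀ), skew(h Xᵀ)⟩ ≥ (1/2)‖skew(g Xᵀ)‖_F² + (1/2)‖skew(h Xᵀ)‖_F² − ((1+ε)/2)·‖g − h‖_F². -/
open Matrix Finset

noncomputable section

lemma finner_eq_sum {n p : ℕ} (A B : Matrix (Fin n) (Fin p) ℝ) :
    finner A B = ∑ i, ∑ j, A i j * B i j := by
  rw [finner, Matrix.trace, Finset.sum_comm]
  simp [Matrix.mul_apply]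

lemma fnorm_sq_eq_finner {n p : ℕ} (A : Matrix (Fin n) (Fin p) ℝ) :
    fnorm A ^ 2 = finner A A := by
  refine Real.sq_sqrt (?_ : 0 ≤ finner A A)
  rw [finner_eq_sum]
  exact Finset.sum_nonneg fun i _ => Finset.sum_nonneg fun j _ => mul_self_nonneg _

lemma fnorm_sq_eq_sum {n p : ℕ} (A : Matrix (Fin n) (Fin p) ℝ) :
    fnorm A ^ 2 = ∑ i, ∑ j, A i j ^ 2 := by
  rw [fnorm_sq_eq_finner, finner_eq_sum]
  simp only [sq]

lemma fnorm_nonneg {n p : ℕ} (A : Matrix (Fin n) (Fin p) ℝ) : 0 ≤ fnorm A :=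
  Real.sqrt_nonneg _

lemma fnorm_sub_sq {n p : ℕ} (A B : Matrix (Fin n) (Fin p) ℝ) :
    fnorm (A - B) ^ 2 = fnorm A ^ 2 - 2 * finner A B + fnorm B ^ 2 := by
  simp only [fnorm_sq_eq_sum, finner_eq_sum, Finset.mul_sum, ← Finset.sum_sub_distrib,
    ← Finset.sum_add_distrib, Matrix.sub_apply]
  refine Finset.sum_congr rfl fun i _ => Finset.sum_congr rfl fun j _ => ?_
  ring

/-- Cauchy–Schwarz for the Frobenius inner product. -/
lemma finner_le_fnorm_mul_fnorm {n p : ℕ} (A B : Matrix (Fin n) (Fin p) ℝ) :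
    finner A B ≤ fnorm A * fnorm B := by
  refine le_of_sq_le_sq ?_ (mul_nonneg (fnorm_nonneg A) (fnorm_nonneg B))
  rw [mul_pow, fnorm_sq_eq_sum, fnorm_sq_eq_sum, finner_eq_sum]
  simp only [← Fintype.sum_prod_type']
  exact Finset.sum_mul_sq_le_sq_mul_sq _ _ _

/-- The Frobenius norm is submultiplicative. -/
lemma fnorm_mul_le {m n p : ℕ} (A : Matrix (Fin m) (Fin n) ℝ) (B : Matrix (Fin n) (Fin p) ℝ) :
    fnorm (A * B) ≤ fnorm A * fnorm B := by
  refine le_of_sq_le_sq ?_ (mul_nonneg (fnorm_nonneg A) (fnorm_nonneg B))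
  rw [mul_pow, fnorm_sq_eq_sum, fnorm_sq_eq_sum, fnorm_sq_eq_sum B,
    Finset.sum_comm (f := fun i j => B i j ^ 2), Finset.sum_mul_sum]
  refine Finset.sum_le_sum fun i _ => Finset.sum_le_sum fun j _ => ?_
  exact Finset.sum_mul_sq_le_sq_mul_sq univ (A i) (B · j)

lemma fnorm_skewPart_sq_le {m : ℕ} (M : Matrix (Fin m) (Fin m) ℝ) :
    fnorm (skewPart M) ^ 2 ≤ fnorm M ^ 2 := by
  have hT : ∑ i, ∑ j, M j i ^ 2 = ∑ i, ∑ j, M i j ^ 2 := Finset.sum_comm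
  have h : ∑ i, ∑ j, skewPart M i j ^ 2 ≤
      ∑ i, ∑ j, (1 / 2 * M i j ^ 2 + 1 / 2 * M j i ^ 2) := by
    refine Finset.sum_le_sum fun i _ => Finset.sum_le_sum fun j _ => ?_
    simp only [skewPart, Matrix.smul_apply, Matrix.sub_apply, Matrix.transpose_apply, smul_eq_mul]
    nlinarith [sq_nonneg (M i j + M j i)]
  simp only [Finset.sum_add_distrib, ← Finset.mul_sum, hT] at h
  rw [fnorm_sq_eq_sum, fnorm_sq_eq_sum]
  linarith

lemma skewPart_sub {m : ℕ} (M N : Matrix (Fin m) (Fin m) ℝ) :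
    skewPart (M - N) = skewPart M - skewPart N := by
  simp only [skewPart, Matrix.transpose_sub, ← smul_sub]
  congr 1
  abel

lemma fnorm_mul_transpose_sq {m n p : ℕ} (D : Matrix (Fin m) (Fin p) ℝ)
    (X : Matrix (Fin n) (Fin p) ℝ) :
    fnorm (D * Xᵀ) ^ 2 = fnorm D ^ 2 + finner D (D * (Xᵀ * X - 1)) := by
  have h : finner (D * Xᵀ) (D * Xᵀ) = finner D (D * (Xᵀ * X)) := by
    simp only [finner, Matrix.transpose_mul, Matrix.transpose_transpose]
    rw [Matrix.mul_assoc, Matrix.trace_mul_comm]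
    simp only [Matrix.mul_assoc]
  rw [fnorm_sq_eq_finner, fnorm_sq_eq_finner, h]
  simp [finner, Matrix.mul_sub, Matrix.trace_sub]

/-- Right multiplication by `Xᵀ` scales squared Frobenius norms by at most `1 + ‖XᵀX - I‖_F`. -/
lemma fnorm_mul_transpose_sq_le {m n p : ℕ} (D : Matrix (Fin m) (Fin p) ℝ)
    (X : Matrix (Fin n) (Fin p) ℝ) :
    fnorm (D * Xᵀ) ^ 2 ≤ (1 + fnorm (Xᵀ * X - 1)) * fnorm D ^ 2 := by
  have h := (finner_le_fnorm_mul_fnorm D (D * (Xᵀ * X - 1))).trans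
    (mul_le_mul_of_nonneg_left (fnorm_mul_le D (Xᵀ * X - 1)) (fnorm_nonneg D))
  rw [fnorm_mul_transpose_sq]
  linarith

/-- for `X` in the safe region and all `g, h`,
`⟨skew(g Xᵀ), skew(h Xᵀ)⟩ ≥ ½‖skew(g Xᵀ)‖² + ½‖skew(h Xᵀ)‖² − ((1+ε)/2)‖g − h‖²`. -/
theorem skew_inner_lower_bound {n p : ℕ} (ε : ℝ) (hε : ε ∈ Set.Ioo (0 : ℝ) (3 / 4))
    (X : Matrix (Fin n) (Fin p) ℝ) (hX : fnorm (Xᵀ * X - 1) ≤ ε) :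
    ∀ g h : Matrix (Fin n) (Fin p) ℝ,
      finner (skewPart (g * Xᵀ)) (skewPart (h * Xᵀ)) ≥
        (1 / 2) * fnorm (skewPart (g * Xᵀ)) ^ 2 + (1 / 2) * fnorm (skewPart (h * Xᵀ)) ^ 2 -
          ((1 + ε) / 2) * fnorm (g - h) ^ 2 := by
  intro g h
  have hsub := fnorm_sub_sq (skewPart (g * Xᵀ)) (skewPart (h * Xᵀ))
  rw [← skewPart_sub, ← Matrix.sub_mul] at hsub
  have hskew := fnorm_skewPart_sq_le ((g - h) * Xᵀ)
  have hmul := fnorm_mul_transpose_sq_le (g - h) X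
  have hε' := mul_le_mul_of_nonneg_right (add_le_add_right hX 1) (sq_nonneg (fnorm (g - h)))
  linarith
end
end
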